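/- arXiv:1302.4825 — 9 statements merged into one kernel-verified Lean document; each statement's English description precedes it below -/
import Mathlib

section
/- Suppose K is a normal subgroup of a finite group G and x ∈ G is an element whose order is coprime to the order of K. Then the centralizer of the image of x in the quotient group G/K equals the image of the centralizer C_G(x) under the quotient map, i.e. C_{G/K}(x̄) = C_G(x)K/K. -/
/-- If `x` has prime-power exponent coprime to the order of a normal subgroup `K` and `y` commutes
with `x` modulo `K`, then some element of the coset `y K` commutes with `x`. -/
theorem exists_mul_commute_of_pow_prime_pow_eq_one {G : Type*} [Group G] [Finite G]
    (K : Subgroup G) [K.Normal] {p m : ℕ} (hp : p.Prime) (hpK : ¬ p ∣ Nat.card K)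
    {x y : G} (hx : x ^ p ^ m = 1) (hxy : Commute (y : G ⧸ K) (x : G ⧸ K)) :
    ∃ k ∈ K, Commute (y * k) x := by
  classical
  have := Fact.mk hp
  have := Fintype.ofFinite K
  have mem (k : G) (hk : k ∈ K) : y⁻¹ * x * y * k * x⁻¹ ∈ K := by
    rw [← QuotientGroup.eq_one_iff] at hk ⊢
    have h2 : (x : G ⧸ K) * y = y * x := hxy.eq.symm
    simp [mul_assoc, hk, ← mul_assoc (x : G ⧸ K) y, h2]
  let f : K → K := fun k ↦ ⟨y⁻¹ * x * y * k * x⁻¹, mem k k.2⟩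
  have hf : Function.Injective f := fun a b hab ↦ by
    exact Subtype.ext (mul_left_cancel (mul_right_cancel (congrArg Subtype.val hab)))
  let σ : Equiv.Perm K := Equiv.ofBijective f (Finite.injective_iff_bijective.mp hf)
  have hσ (n : ℕ) (k : K) : ((σ ^ n) k : G) = y⁻¹ * x ^ n * y * k * (x ^ n)⁻¹ := by
    induction n with
    | zero => simp
    | succ n ih =>
      rw [pow_succ', Equiv.Perm.mul_apply]
      change y⁻¹ * x * y * ((σ ^ n) k : G) * x⁻¹ = _
      rw [ih]
      group
  have hσ1 : σ ^ p ^ m = 1 := by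
    ext k
    simp [hσ, hx]
  obtain ⟨k, hk⟩ := Equiv.Perm.exists_fixed_point_of_prime
    (by rwa [← Nat.card_eq_fintype_card]) hσ1
  refine ⟨k, k.2, ?_⟩
  have hk' : y⁻¹ * x * y * k * x⁻¹ = k := congrArg Subtype.val hk
  rw [mul_inv_eq_iff_eq_mul, mul_assoc, mul_assoc, inv_mul_eq_iff_eq_mul] at hk'
  rw [commute_iff_eq, hk', mul_assoc]

/-- If `x` has exponent coprime to the order of a normal subgroup `K` and `y` commutes with `x`
modulo `K`, then some element of the coset `y K` commutes with `x`. -/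
theorem exists_mul_commute_of_pow_eq_one_of_coprime {G : Type*} [Group G] [Finite G]
    (K : Subgroup G) [K.Normal] {n : ℕ} (hn : n.Coprime (Nat.card K))
    {x y : G} (hx : x ^ n = 1) (hxy : Commute (y : G ⧸ K) (x : G ⧸ K)) :
    ∃ k ∈ K, Commute (y * k) x := by
  induction n using Nat.recOnPosPrimePosCoprime generalizing G with
  | prime_pow p m hp hm =>
    exact exists_mul_commute_of_pow_prime_pow_eq_one K hp
      (hp.coprime_iff_not_dvd.mp ((Nat.coprime_pow_left_iff hm _ _).mp hn)) hx hxy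
  | zero =>
    have hK : K = ⊥ := Subgroup.card_eq_one.mp (by simpa using hn)
    subst hK
    refine ⟨1, one_mem _, ?_⟩
    have h := QuotientGroup.eq.mp hxy.eq
    rw [Subgroup.mem_bot, inv_mul_eq_one] at h
    simpa [commute_iff_eq] using h
  | one => exact ⟨1, one_mem _, by simp_all⟩
  | coprime a b ha hb hab iha ihb =>
    obtain ⟨k, hkK, hk⟩ := ihb K hn.coprime_mul_left (x := x ^ a)
      (by rwa [← pow_mul]) (by simpa using hxy.pow_right a)
    let C := Subgroup.centralizer {x ^ a}
    have hyC : y * k ∈ C := Subgroup.mem_centralizer_singleton_iff.mpr hk.eq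
    have hxC : x ^ b ∈ C :=
      Subgroup.mem_centralizer_singleton_iff.mpr (Commute.pow_pow_self x b a).eq
    have hcard : Nat.card (K.subgroupOf C) ∣ Nat.card K :=
      Subgroup.card_comap_dvd_of_injective K C.subtype C.subtype_injective
    have hcomm : Commute ((⟨y * k, hyC⟩ : C) : C ⧸ K.subgroupOf C) ((⟨x ^ b, hxC⟩ : C)) := by
      refine QuotientGroup.eq.mpr (Subgroup.mem_subgroupOf.mpr ?_)
      have h : Commute ((y * k : G) : G ⧸ K) ((x ^ b : G) : G ⧸ K) := by
        simpa [(QuotientGroup.eq_one_iff k).mpr hkK] using hxy.pow_right b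
      exact QuotientGroup.eq.mp h.eq
    obtain ⟨l, hlK, hl⟩ := iha (K.subgroupOf C)
      (hn.coprime_mul_right.coprime_dvd_right hcard) (x := ⟨x ^ b, hxC⟩) (y := ⟨y * k, hyC⟩)
      (Subtype.ext (by simpa [← pow_mul, mul_comm b a] using hx)) hcomm
    refine ⟨k * l, mul_mem hkK (Subgroup.mem_subgroupOf.mp hlK), ?_⟩
    rw [← mul_assoc]
    have h1 : Commute (y * k * l) (x ^ a) :=
      hk.mul_left (Subgroup.mem_centralizer_singleton_iff.mp l.2)
    have h2 : Commute (y * k * l) (x ^ b) := congrArg Subtype.val hl.eq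
    have hbez : x = (x ^ a) ^ a.gcdA b * (x ^ b) ^ a.gcdB b := by
      rw [← zpow_natCast, ← zpow_natCast, ← zpow_mul, ← zpow_mul, ← zpow_add,
        ← Nat.gcd_eq_gcd_ab, hab.gcd_eq_one, Nat.cast_one, zpow_one]
    rw [hbez]
    exact (h1.zpow_right _).mul_right (h2.zpow_right _)

theorem centralizer_quotient_of_coprime
    (G : Type*) [Group G] [Finite G] (K : Subgroup G) [K.Normal]
    (x : G) (h : Nat.Coprime (orderOf x) (Nat.card K)) :
    Subgroup.centralizer {((QuotientGroup.mk' K) x : G ⧸ K)} =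
      Subgroup.map (QuotientGroup.mk' K) (Subgroup.centralizer {x}) := by
  apply le_antisymm
  · intro q hq
    obtain ⟨y, rfl⟩ := QuotientGroup.mk'_surjective K q
    obtain ⟨k, hkK, hk⟩ := exists_mul_commute_of_pow_eq_one_of_coprime K h (pow_orderOf_eq_one x)
      (Subgroup.mem_centralizer_singleton_iff.mp hq)
    refine ⟨y * k, Subgroup.mem_centralizer_singleton_iff.mpr hk.eq, ?_⟩
    simp [(QuotientGroup.eq_one_iff k).mpr hkK]
  · rintro _ ⟨y, hy, rfl⟩
    have hxy : Commute y x := Subgroup.mem_centralizer_singleton_iff.mp hy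
    exact Subgroup.mem_centralizer_singleton_iff.mpr (hxy.map (QuotientGroup.mk' K)).eq
end

section
/- Let G be a finite group with normal subgroups K ≤ M (both normal in G), and let p, q, r be pairwise distinct primes such that p divides |K|, q divides |M/K| and r divides |G/M|. Then p, q, r cannot be pairwise non-adjacent in the prime graph of G; that is, at least one of the products pq, pr, qr lies in ω(G). -/
/-- The spectrum of a group: the set of orders of its elements. -/
def groupSpectrum (G : Type*) [Group G] : Set ℕ := {k : ℕ | ∃ g : G, orderOf g = k}

/-- If `x` has no nontrivial fixed point in `A`, neither has a finite subgroup `Q` normalized by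
`x`, and the nontrivial powers of `x` centralize no nontrivial element of `Q`, then the order of
`Q` annihilates `A`. -/
theorem pow_card_eq_one_of_fixedPointFree {N A : Type*} [Group N] [CommGroup A]
    [MulDistribMulAction N A] (Q : Subgroup N) [Finite Q] (x : N) (r : ℕ) (hr : 0 < r)
    (hx : x ^ r = 1) (hxQ : x ∈ Subgroup.normalizer (Q : Set N))
    (hfree : ∀ i, 0 < i → i < r → ∀ u ∈ Q, Commute (x ^ i) u → u = 1)
    (hQA : ∀ a : A, (∀ u ∈ Q, u • a = a) → a = 1)
    (hxA : ∀ a : A, x • a = a → a = 1) (a : A) : a ^ Nat.card Q = 1 := by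
  classical
  have := Fintype.ofFinite Q
  have orbit_x (b : A) : ∏ i ∈ Finset.range r, x ^ i • b = 1 := by
    apply hxA
    rw [Finset.smul_prod']
    simp only [smul_smul, ← pow_succ']
    have h := Finset.prod_range_succ' (fun i ↦ x ^ i • b) r
    rw [Finset.prod_range_succ, hx, pow_zero] at h
    exact (mul_right_cancel h).symm
  have orbit_Q : ∏ u : Q, (u : N) • a = 1 :=
    hQA _ fun u hu ↦ Finset.smul_prod_perm (G := Q) a ⟨u, hu⟩
  have conj_sum : ∏ u : Q, ∏ i ∈ Finset.range r, ((u : N) * x ^ i * (u : N)⁻¹) • a = 1 := by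
    refine Finset.prod_eq_one fun u _ ↦ ?_
    simp only [mul_smul, ← Finset.smul_prod', orbit_x, smul_one]
  have coset_sum (i : ℕ) (h0 : 0 < i) (hi : i < r) :
      ∏ u : Q, ((u : N) * x ^ i * (u : N)⁻¹) • a = 1 := by
    have hmem (u : Q) : (x ^ i)⁻¹ * u * x ^ i * (u : N)⁻¹ ∈ Q := by
      refine Q.mul_mem ?_ (Q.inv_mem u.2)
      have := (Subgroup.mem_normalizer_iff.1 (inv_mem (pow_mem hxQ i)) u).1 u.2
      simpa using this
    let f : Q → Q := fun u ↦ ⟨_, hmem u⟩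
    have hf : f.Bijective := by
      refine Finite.injective_iff_bijective.1 fun u v huv ↦ ?_
      have h : (x ^ i)⁻¹ * u * x ^ i * (u : N)⁻¹ = (x ^ i)⁻¹ * v * x ^ i * (v : N)⁻¹ :=
        congrArg Subtype.val huv
      have hc : Commute (x ^ i) ((v : N)⁻¹ * u) := by
        have h' : (u : N) * x ^ i * (u : N)⁻¹ = v * x ^ i * (v : N)⁻¹ := by
          simpa [mul_assoc] using h
        calc x ^ i * ((v : N)⁻¹ * u) = (v : N)⁻¹ * (v * x ^ i * (v : N)⁻¹) * u := by group
          _ = (v : N)⁻¹ * u * x ^ i := by rw [← h']; group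
      have := hfree i h0 hi _ (Q.mul_mem (Q.inv_mem v.2) u.2) hc
      exact Subtype.ext (inv_mul_eq_one.1 this).symm
    have hsplit (u : Q) : ((u : N) * x ^ i * (u : N)⁻¹) • a = x ^ i • (f u : N) • a := by
      rw [smul_smul]
      congr 1
      simp only [f]
      group
    simp only [hsplit, ← Finset.smul_prod']
    rw [hf.prod_comp (fun u : Q ↦ (u : N) • a), orbit_Q, smul_one]
  rw [Finset.prod_comm, Finset.prod_eq_single_of_mem 0 (Finset.mem_range.2 hr) fun i hi h0 ↦
    coset_sum i (Nat.pos_of_ne_zero h0) (Finset.mem_range.1 hi)] at conj_sum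
  simpa using conj_sum

theorem mul_mem_groupSpectrum_of_commute {G : Type*} [Group G] [Finite G] {p q : ℕ}
    (hpq : p.Coprime q) {a b : G} (hab : Commute a b)
    (ha : p ∣ orderOf a) (hb : q ∣ orderOf b) : p * q ∈ groupSpectrum G := by
  have ha' := orderOf_pow_orderOf_div (orderOf_pos a).ne' ha
  have hb' := orderOf_pow_orderOf_div (orderOf_pos b).ne' hb
  refine ⟨a ^ (orderOf a / p) * b ^ (orderOf b / q), ?_⟩
  rw [(hab.pow_pow _ _).orderOf_mul_eq_mul_orderOf_of_coprime (by rwa [ha', hb']), ha', hb']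

theorem groupSpectrum_subset_of_injective {G H : Type*} [Group G] [Group H] (f : G →* H)
    (hf : Function.Injective f) : groupSpectrum G ⊆ groupSpectrum H := by
  rintro _ ⟨g, rfl⟩
  exact ⟨f g, orderOf_injective f hf g⟩

theorem IsPGroup.dvd_orderOf_of_ne_one {G : Type*} [Group G] {p : ℕ} [Fact p.Prime]
    (hG : IsPGroup p G) {g : G} (hg : g ≠ 1) : p ∣ orderOf g := by
  obtain ⟨k, hk⟩ := IsPGroup.iff_orderOf.1 hG g
  rw [hk]
  refine dvd_pow_self p fun h0 ↦ hg ?_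
  rwa [h0, pow_zero, orderOf_eq_one_iff] at hk

open scoped IsMulCommutative in
/-- The case of a nontrivial commutative normal `p`-subgroup `V`. -/
theorem mul_mem_groupSpectrum_of_isMulCommutative {G : Type*} [Group G] [Finite G]
    (V M : Subgroup G) [V.Normal] [IsMulCommutative V] [M.Normal]
    {p q r : ℕ} (hp : p.Prime) (hq : q.Prime) (hr : r.Prime)
    (hpq : p ≠ q) (hpr : p ≠ r) (hqr : q ≠ r)
    (hVp : IsPGroup p V) (hV : V ≠ ⊥) (hqM : q ∣ Nat.card M) (hrM : r ∣ M.index) :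
    p * q ∈ groupSpectrum G ∨ p * r ∈ groupSpectrum G ∨ q * r ∈ groupSpectrum G := by
  have := Fact.mk hp
  have := Fact.mk hq
  have := Fact.mk hr
  by_contra! hcon
  obtain ⟨hcpq, hcpr, hcqr⟩ := hcon
  obtain ⟨S⟩ : Nonempty (Sylow q M) := inferInstance
  set Q : Subgroup G := (S : Subgroup M).map M.subtype
  have hQq : IsPGroup q Q := S.isPGroup'.map _
  have hQ : Q ≠ ⊥ := fun h ↦ S.ne_bot_of_dvd_card hqM
    ((Subgroup.map_eq_bot_iff_of_injective _ M.subtype_injective).1 h)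
  have hfrattini : Subgroup.normalizer (Q : Set G) ⊔ M = ⊤ := S.normalizer_sup_eq_top
  obtain ⟨x, hx⟩ : ∃ x : Subgroup.normalizer (Q : Set G), orderOf x = r := by
    refine exists_prime_orderOf_dvd_card' r (hrM.trans ?_)
    rw [← Subgroup.relIndex_top_right, ← hfrattini, Subgroup.relIndex_sup_right]
    exact Subgroup.relIndex_dvd_card _ _
  rw [← Subgroup.orderOf_coe] at hx
  have commute_of_fixed (g : G) (a : V) (h : MulAut.conjNormal g a = a) : Commute (a : G) g := by
    have h' : g * a * g⁻¹ = a := by rw [← MulAut.conjNormal_apply, h]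
    exact (mul_inv_eq_iff_eq_mul.1 h').symm
  have dvd_V (a : V) (ha : a ≠ 1) : p ∣ orderOf (a : G) := by
    rw [Subgroup.orderOf_coe]
    exact hVp.dvd_orderOf_of_ne_one ha
  have dvd_Q (u : G) (hu : u ∈ Q) (h1 : u ≠ 1) : q ∣ orderOf u := by
    rw [← Subgroup.orderOf_mk u hu]
    exact hQq.dvd_orderOf_of_ne_one fun h ↦ h1 (congrArg Subtype.val h)
  obtain ⟨u, hu, hu1⟩ := Q.bot_or_exists_ne_one.resolve_left hQ
  obtain ⟨a, ha⟩ := Subgroup.ne_bot_iff_exists_ne_one.1 hV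
  let _ : MulDistribMulAction G V := MulDistribMulAction.compHom V (MulAut.conjNormal (H := V))
  have key : a ^ Nat.card Q = 1 := by
    refine pow_card_eq_one_of_fixedPointFree Q (x : G) r hr.pos (hx ▸ pow_orderOf_eq_one _) x.2
      ?_ ?_ ?_ a
    · intro i h0 hi v hv hc
      by_contra hv1
      refine hcqr (mul_mem_groupSpectrum_of_commute ((Nat.coprime_primes hq hr).2 hqr) hc.symm
        (dvd_Q v hv hv1) ?_)
      rw [Nat.Coprime.orderOf_pow, hx]
      rw [hx]
      exact Nat.coprime_of_lt_prime h0.ne' hi hr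
    · intro b hb
      by_contra hb1
      exact hcpq (mul_mem_groupSpectrum_of_commute ((Nat.coprime_primes hp hq).2 hpq)
        (commute_of_fixed u b (hb u hu)) (dvd_V b hb1) (dvd_Q u hu hu1))
    · intro b hb
      by_contra hb1
      exact hcpr (mul_mem_groupSpectrum_of_commute ((Nat.coprime_primes hp hr).2 hpr)
        (commute_of_fixed x b hb) (dvd_V b hb1) hx.symm.dvd)
  obtain ⟨n, hn⟩ := hQq.exists_card_eq
  have hpdvd := (hVp.dvd_orderOf_of_ne_one ha).trans (orderOf_dvd_of_pow_eq_one key)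
  rw [hn] at hpdvd
  exact hpq ((Nat.prime_dvd_prime_iff_eq hp hq).1 (hp.dvd_of_dvd_pow hpdvd))

theorem not_pairwise_nonadjacent
    (G : Type*) [Group G] [Finite G]
    (K M : Subgroup G) [K.Normal] [M.Normal] (hKM : K ≤ M)
    (p q r : ℕ) (hp : p.Prime) (hq : q.Prime) (hr : r.Prime)
    (hpq : p ≠ q) (hpr : p ≠ r) (hqr : q ≠ r)
    (hpK : p ∣ Nat.card K)
    (hqM : q ∣ Nat.card (M ⧸ K.subgroupOf M))
    (hrG : r ∣ Nat.card (G ⧸ M)) :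
    p * q ∈ groupSpectrum G ∨ p * r ∈ groupSpectrum G ∨ q * r ∈ groupSpectrum G := by
  have := Fact.mk hp
  obtain ⟨S⟩ : Nonempty (Sylow p K) := inferInstance
  set P : Subgroup G := (S : Subgroup K).map K.subtype
  set N : Subgroup G := Subgroup.normalizer (P : Set G)
  have hfrattini : N ⊔ K = ⊤ := S.normalizer_sup_eq_top
  have hP : P ≠ ⊥ := fun h ↦ S.ne_bot_of_dvd_card hpK
    ((Subgroup.map_eq_bot_iff_of_injective _ K.subtype_injective).1 h)
  have hPN : P ≤ N := Subgroup.le_normalizer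
  set R : Subgroup N := P.subgroupOf N with hRdef
  have : R.Normal := Subgroup.normal_in_normalizer
  have hRp : IsPGroup p R :=
    (S.isPGroup'.map K.subtype).comap_of_injective N.subtype N.subtype_injective
  have : Nontrivial R := by
    rw [Subgroup.nontrivial_iff_ne_bot, hRdef, Ne, Subgroup.subgroupOf_eq_bot]
    exact fun h ↦ hP (h.eq_bot_of_le hPN)
  have hZ : (Subgroup.center R).map R.subtype ≠ ⊥ := by
    rw [Ne, Subgroup.map_eq_bot_iff_of_injective _ R.subtype_injective]
    exact (Subgroup.nontrivial_iff_ne_bot _).1 hRp.center_nontrivial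
  have hqN : q ∣ Nat.card (M.subgroupOf N) := by
    have hmod : (N ⊓ M) ⊔ K = M := by
      refine le_antisymm (sup_le inf_le_right hKM) fun m hm ↦ ?_
      have hm' : m ∈ N ⊔ K := hfrattini ▸ Subgroup.mem_top m
      rw [Subgroup.mem_sup_of_normal_right] at hm'
      obtain ⟨n, hn, k, hk, rfl⟩ := hm'
      exact Subgroup.mul_mem_sup ⟨hn, (Subgroup.mul_mem_cancel_right M (hKM hk)).1 hm⟩ hk
    have hdvd : q ∣ K.relIndex M := hqM
    rw [← hmod, Subgroup.relIndex_sup_right] at hdvd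
    have hcard : Nat.card (M.subgroupOf N) = Nat.card (N ⊓ M : Subgroup G) := by
      rw [inf_comm, ← Subgroup.subgroupOf_map_subtype M N]
      exact (Subgroup.card_map_of_injective N.subtype_injective).symm
    rw [hcard]
    exact hdvd.trans (Subgroup.relIndex_dvd_card _ _)
  have hrN : r ∣ (M.subgroupOf N).index := by
    have htop : N ⊔ M = ⊤ := top_le_iff.1 (hfrattini ▸ sup_le_sup_left hKM N)
    have hdvd : r ∣ M.index := hrG
    rwa [← Subgroup.relIndex_top_right, ← htop, Subgroup.relIndex_sup_right] at hdvd
  have hmono := groupSpectrum_subset_of_injective N.subtype N.subtype_injective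
  exact (mul_mem_groupSpectrum_of_isMulCommutative ((Subgroup.center R).map R.subtype)
    (M.subgroupOf N) hp hq hr hpq hpr hqr ((hRp.to_subgroup _).map _) hZ hqN hrN).imp
      (@hmono _) (Or.imp (@hmono _) (@hmono _))
end

section
/- For every natural number n > 6, the spectrum of the alternating group A_n is not contained in the spectrum of the symmetric group S_{n-1}, i.e. ω(A_n) ⊄ ω(S_{n-1}). -/
theorem Finset.sum_le_prod_of_two_le {s : Finset ℕ} (hs : ∀ p ∈ s, 2 ≤ p) :
    ∑ p ∈ s, p ≤ ∏ p ∈ s, p := by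
  induction s using Finset.induction_on with
  | empty => simp
  | insert a s ha ih =>
    have ha2 := hs a (mem_insert_self a s)
    have hs2 : ∀ p ∈ s, 2 ≤ p := fun p hp => hs p (mem_insert_of_mem hp)
    specialize ih hs2
    rw [sum_insert ha, prod_insert ha]
    rcases s.eq_empty_or_nonempty with rfl | ⟨b, hb⟩
    · simp
    · have hP : 2 ≤ ∑ p ∈ s, p :=
        (hs2 b hb).trans (single_le_sum (f := fun p => p) (fun _ _ => Nat.zero_le _) hb)
      nlinarith

theorem Finset.sum_le_of_forall_prime_dvd {s : Finset ℕ} {c : ℕ} (hc : c ≠ 0)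
    (hs : ∀ p ∈ s, p.Prime) (hdvd : ∀ p ∈ s, p ∣ c) : ∑ p ∈ s, p ≤ c :=
  (sum_le_prod_of_two_le fun p hp => (hs p hp).two_le).trans <|
    Nat.le_of_dvd (Nat.pos_of_ne_zero hc) <|
      prod_primes_dvd c (fun p hp => (hs p hp).prime) hdvd

theorem Finset.sum_le_multiset_sum_of_forall_prime_dvd_lcm {s : Finset ℕ} {m : Multiset ℕ}
    (hm : 0 ∉ m) (hs : ∀ p ∈ s, p.Prime) (hdvd : ∀ p ∈ s, p ∣ m.lcm) :
    ∑ p ∈ s, p ≤ m.sum := by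
  induction m using Multiset.induction_on generalizing s with
  | empty =>
    have : s = ∅ := eq_empty_of_forall_notMem fun p hp =>
      (hs p hp).one_lt.ne' (by simpa using hdvd p hp)
    simp [this]
  | cons c m ih =>
    rw [Multiset.mem_cons, not_or] at hm
    rw [Multiset.sum_cons, ← sum_filter_add_sum_filter_not s (· ∣ c)]
    refine add_le_add (sum_le_of_forall_prime_dvd (Ne.symm hm.1) ?_ ?_) (ih hm.2 ?_ ?_)
    · exact fun p hp => hs p (mem_filter.1 hp).1
    · exact fun p hp => (mem_filter.1 hp).2
    · exact fun p hp => hs p (mem_filter.1 hp).1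
    · intro p hp
      obtain ⟨hp, hpc⟩ := mem_filter.1 hp
      have h := hdvd p hp
      rw [Multiset.lcm_cons] at h
      exact ((hs p hp).prime.dvd_or_dvd_of_dvd_lcm h).resolve_left hpc

/-- If all integers in `(9, 9 + q]` are sums of distinct odd primes less than `q`, then Bertrand's
postulate provides a larger prime with the same property. -/
theorem Nat.exists_large_prime_forall_exists_sum_odd_primes (k : ℕ) :
    ∃ q : ℕ, q.Prime ∧ 19 + k ≤ q ∧ ∀ n, 9 < n → n ≤ 9 + q →
      ∃ s : Finset ℕ, (∀ p ∈ s, p.Prime ∧ Odd p ∧ p < q) ∧ ∑ p ∈ s, p = n := by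
  induction k with
  | zero =>
    refine ⟨19, by norm_num, by norm_num, fun n h₁ h₂ => ?_⟩
    obtain ⟨s, hs, hsum⟩ : ∃ s ⊆ ({3, 5, 7, 11, 13, 17} : Finset ℕ), ∑ p ∈ s, p = n := by
      interval_cases n
      · exact ⟨{3, 7}, by decide, rfl⟩
      · exact ⟨{11}, by decide, rfl⟩
      · exact ⟨{5, 7}, by decide, rfl⟩
      · exact ⟨{13}, by decide, rfl⟩
      · exact ⟨{3, 11}, by decide, rfl⟩
      · exact ⟨{3, 5, 7}, by decide, rfl⟩
      · exact ⟨{3, 13}, by decide, rfl⟩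
      · exact ⟨{17}, by decide, rfl⟩
      · exact ⟨{5, 13}, by decide, rfl⟩
      · exact ⟨{3, 5, 11}, by decide, rfl⟩
      · exact ⟨{3, 17}, by decide, rfl⟩
      · exact ⟨{3, 5, 13}, by decide, rfl⟩
      · exact ⟨{5, 17}, by decide, rfl⟩
      · exact ⟨{5, 7, 11}, by decide, rfl⟩
      · exact ⟨{7, 17}, by decide, rfl⟩
      · exact ⟨{5, 7, 13}, by decide, rfl⟩
      · exact ⟨{3, 5, 7, 11}, by decide, rfl⟩
      · exact ⟨{3, 7, 17}, by decide, rfl⟩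
      · exact ⟨{11, 17}, by decide, rfl⟩
    refine ⟨s, fun p hp => ?_, hsum⟩
    have := hs hp
    simp only [Finset.mem_insert, Finset.mem_singleton] at this
    rcases this with rfl | rfl | rfl | rfl | rfl | rfl <;> norm_num
  | succ k ih =>
    obtain ⟨q, hq, hkq, h⟩ := ih
    obtain ⟨r, hr, hqr, hrq⟩ := exists_prime_lt_and_le_two_mul q hq.ne_zero
    refine ⟨r, hr, by lia, fun n h₁ h₂ => ?_⟩
    by_cases hn : n ≤ 9 + q
    · obtain ⟨s, hs, hsum⟩ := h n h₁ hn
      exact ⟨s, fun p hp => ⟨(hs p hp).1, (hs p hp).2.1, (hs p hp).2.2.trans hqr⟩, hsum⟩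
    · obtain ⟨s, hs, hsum⟩ := h (n - q) (by lia) (by lia)
      have hqs : q ∉ s := fun hmem => lt_irrefl q (hs q hmem).2.2
      refine ⟨insert q s, fun p hp => ?_, by rw [Finset.sum_insert hqs]; lia⟩
      rcases Finset.mem_insert.1 hp with rfl | hp
      · exact ⟨hq, hq.odd_of_ne_two (by lia), hqr⟩
      · exact ⟨(hs p hp).1, (hs p hp).2.1, (hs p hp).2.2.trans hqr⟩

theorem Nat.exists_sum_distinct_odd_primes {n : ℕ} (hn : 9 < n) :
    ∃ s : Finset ℕ, (∀ p ∈ s, p.Prime ∧ Odd p) ∧ ∑ p ∈ s, p = n := by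
  obtain ⟨q, -, hq, h⟩ := exists_large_prime_forall_exists_sum_odd_primes n
  obtain ⟨s, hs, hsum⟩ := h n hn (by lia)
  exact ⟨s, fun p hp => ⟨(hs p hp).1, (hs p hp).2.1⟩, hsum⟩

theorem lcm_mem_groupSpectrum_alternatingGroup {n : ℕ} {m : Multiset ℕ}
    (hsum : m.sum ≤ n) (hm : ∀ a ∈ m, 2 ≤ a ∧ Odd a) :
    m.lcm ∈ groupSpectrum (alternatingGroup (Fin n)) := by
  obtain ⟨g, rfl⟩ := (Equiv.Perm.exists_with_cycleType_iff (Fin n)).2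
    ⟨by simpa using hsum, fun a ha => (hm a ha).1⟩
  refine ⟨⟨g, ?_⟩, ?_⟩
  · rw [Equiv.Perm.mem_alternatingGroup, Equiv.Perm.sign_of_cycleType']
    refine Multiset.prod_eq_one fun x hx => ?_
    obtain ⟨a, ha, rfl⟩ := Multiset.mem_map.1 hx
    simp [(hm a ha).2.neg_one_pow]
  · rw [Subgroup.orderOf_mk, Equiv.Perm.lcm_cycleType]

theorem nine_notMem_groupSpectrum_perm_fin_eight :
    9 ∉ groupSpectrum (Equiv.Perm (Fin 8)) := by
  rintro ⟨g, hg⟩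
  have h : g.cycleType.lcm ∣ 3 := by
    refine Multiset.lcm_dvd.2 fun a ha => ?_
    have h9 : a ∣ 9 := hg ▸ Equiv.Perm.dvd_of_mem_cycleType ha
    have h8 : a ≤ 8 := by
      simpa using (Multiset.le_sum_of_mem ha).trans g.sum_cycleType_le
    interval_cases a <;> revert h9 <;> decide
  rw [Equiv.Perm.lcm_cycleType, hg] at h
  revert h
  decide

theorem spectrum_alternating_not_subset_symm_pred
    (n : ℕ) (hn : 6 < n) :
    ¬ groupSpectrum (alternatingGroup (Fin n)) ⊆ groupSpectrum (Equiv.Perm (Fin (n - 1))) := by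
  intro hsub
  by_cases h9 : n = 9
  · subst h9
    refine nine_notMem_groupSpectrum_perm_fin_eight (hsub ?_)
    simpa using lcm_mem_groupSpectrum_alternatingGroup (n := 9) (m := {9}) (by simp)
      (by decide)
  obtain ⟨s, hs, hsum⟩ : ∃ s : Finset ℕ, (∀ p ∈ s, p.Prime ∧ Odd p) ∧ ∑ p ∈ s, p = n := by
    rcases lt_or_ge 9 n with h | h
    · exact Nat.exists_sum_distinct_odd_primes h
    · obtain rfl | rfl : n = 7 ∨ n = 8 := by lia
      · exact ⟨{7}, by norm_num, rfl⟩
      · exact ⟨{3, 5}, by norm_num, rfl⟩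
  obtain ⟨g, hg⟩ := hsub <| lcm_mem_groupSpectrum_alternatingGroup (m := s.val)
    (by rw [← hsum]; exact (Finset.sum_val s).le) fun p hp => ⟨(hs p hp).1.two_le, (hs p hp).2⟩
  have hle : ∑ p ∈ s, p ≤ g.cycleType.sum := by
    refine Finset.sum_le_multiset_sum_of_forall_prime_dvd_lcm
      (fun h0 => absurd (Equiv.Perm.two_le_of_mem_cycleType h0) (by decide))
      (fun p hp => (hs p hp).1) fun p hp => ?_
    rw [Equiv.Perm.lcm_cycleType, hg]
    exact Multiset.dvd_lcm hp
  have hcard := g.sum_cycleType_le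
  rw [Fintype.card_fin] at hcard
  lia
end

section
/- Let n ≥ 5 and let r be a prime with n/2 < r < n - 2. If g is an element of the alternating group A_n of order r, then the centralizer of g in A_n is isomorphic to the direct product ⟨g⟩ × A_{n-r}, i.e. C_{A_n}(g) ≅ (ℤ/rℤ) × A_{n-r}. -/
open Equiv Equiv.Perm Subgroup in
/-- A permutation commuting with a cycle `c` agrees with some power of `c` on the support of `c`. -/
theorem Equiv.Perm.IsCycle.exists_support_zpow_inv_mul_subset {α : Type*} [Fintype α]
    [DecidableEq α] {k c : Perm α} (hc : c.IsCycle) (hk : Commute k c) :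
    ∃ i : ℤ, ((c ^ i)⁻¹ * k).support ⊆ c.supportᶜ := by
  obtain ⟨hc', i, hi⟩ := hc.commute_iff.mp hk
  refine ⟨i, fun x hx ↦ ?_⟩
  rw [Finset.mem_compl]
  contrapose! hx
  have h : (c ^ i) x = k x := (Perm.congr_fun hi x).trans (ofSubtype_subtypePerm_of_mem hc' hx)
  rw [notMem_support, Perm.mul_apply, Perm.inv_eq_iff_eq, h]

open Equiv Equiv.Perm Subgroup in
/-- The centralizer of a cycle in the alternating group is the direct product of the cyclic group it
generates and the alternating group on its fixed points. -/
theorem alternatingGroup.nonempty_centralizer_mulEquiv_of_isCycle {α : Type*} [Fintype α]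
    [DecidableEq α] (g : alternatingGroup α) (hg : (g : Perm α).IsCycle) :
    Nonempty (centralizer {g} ≃*
      zpowers g × alternatingGroup ((g : Perm α).supportᶜ : Finset α)) := by
  set s : Finset α := (g : Perm α).supportᶜ with hs
  have disj (i : ℤ) {k : alternatingGroup α} (hk : k ∈ (ofSubtype s).range) :
      Perm.Disjoint ((g : Perm α) ^ i) k := by
    rw [mem_range_ofSubtype_iff] at hk
    rw [disjoint_iff_disjoint_support]
    exact Disjoint.mono (support_zpow_le _ i) hk disjoint_compl_right
  have comm (x : zpowers g) (y : alternatingGroup s) :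
      Commute ((zpowers g).subtype x) (ofSubtype s y) := by
    obtain ⟨_, i, rfl⟩ := x
    exact Subtype.ext (disj i ⟨y, rfl⟩).commute
  have hinj : Function.Injective ((zpowers g).subtype.noncommCoprod (ofSubtype s) comm) := by
    rw [MonoidHom.noncommCoprod_injective]
    refine ⟨subtype_injective _, ofSubtype_injective, ?_⟩
    rw [range_subtype, Subgroup.disjoint_def]
    rintro _ ⟨i, rfl⟩ hk
    exact Subtype.ext (disjoint_refl_iff.mp (disj i hk))
  have hrange : ((zpowers g).subtype.noncommCoprod (ofSubtype s) comm).range = centralizer {g} := by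
    rw [MonoidHom.noncommCoprod_range, range_subtype]
    apply le_antisymm
    · rw [sup_le_iff, zpowers_le, mem_centralizer_singleton_iff]
      refine ⟨rfl, ?_⟩
      rintro _ ⟨y, rfl⟩
      rw [mem_centralizer_singleton_iff]
      exact (comm ⟨g, mem_zpowers g⟩ y).symm
    · intro k hk
      rw [mem_centralizer_singleton_iff] at hk
      obtain ⟨i, hi⟩ := hg.exists_support_zpow_inv_mul_subset (congrArg Subtype.val hk)
      rw [← mul_inv_cancel_left (g ^ i) k]
      exact mul_mem_sup (zpow_mem_zpowers g i) ((mem_range_ofSubtype_iff s _).mpr hi)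
  exact ⟨((MonoidHom.ofInjective hinj).trans (MulEquiv.subgroupCongr hrange)).symm⟩

theorem centralizer_of_large_prime_order_elem
    (n r : ℕ) (hn : 5 ≤ n) (hr : r.Prime) (h1 : 2 * r > n) (h2 : r < n - 2)
    (g : alternatingGroup (Fin n)) (hg : orderOf g = r) :
    Nonempty (Subgroup.centralizer {g} ≃*
      Multiplicative (ZMod r) × alternatingGroup (Fin (n - r))) := by
  have hord : orderOf (g : Equiv.Perm (Fin n)) = r := by rw [Subgroup.orderOf_coe, hg]
  have hcyc : (g : Equiv.Perm (Fin n)).IsCycle :=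
    Equiv.Perm.isCycle_of_prime_order' (by rwa [hord]) (by rwa [hord, Fintype.card_fin])
  have hcard : Fintype.card ((g : Equiv.Perm (Fin n)).supportᶜ : Finset (Fin n)) = n - r := by
    rw [Fintype.card_coe, Finset.card_compl, Fintype.card_fin, ← hcyc.orderOf, hord]
  have hz : Nat.card (Subgroup.zpowers g) = Nat.card (Multiplicative (ZMod r)) := by
    rw [Nat.card_zpowers, hg]
    exact (Nat.card_zmod r).symm
  obtain ⟨e⟩ := alternatingGroup.nonempty_centralizer_mulEquiv_of_isCycle g hcyc
  exact ⟨e.trans ((mulEquivOfCyclicCardEq hz).prodCongr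
    (Fintype.equivFinOfCardEq hcard).altCongrHom)⟩
end

section
/- Let n ≥ 26 with n ≠ 27, let p be the largest prime not exceeding n, and suppose n - p > 2. Then there exist two distinct primes r₁ and r₂ with n/2 < rᵢ < p for i = 1, 2 such that n - rᵢ ∉ {3, 4, 6, 10} for i = 1, 2. -/
theorem centralBinom_le_pow_card_bertrand_primes (n : ℕ) (n_large : 2 < n) :
    n.centralBinom ≤ (2 * n) ^ Nat.sqrt (2 * n) * 4 ^ (2 * n / 3) *
      (2 * n) ^ ((Finset.Ioc n (2 * n)).filter Nat.Prime).card := by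
  have n2_pos : 1 ≤ 2 * n := by omega
  let S := (Finset.range (2 * n / 3 + 1)).filter Nat.Prime
  let T := (Finset.Ioc n (2 * n)).filter Nat.Prime
  let f x := x ^ n.centralBinom.factorization x
  have hdisj : Disjoint S T := by
    rw [Finset.disjoint_left]
    intro x hx hx'
    simp only [S, T, Finset.mem_filter, Finset.mem_range, Finset.mem_Ioc] at hx hx'
    omega
  have hprod : n.centralBinom = ∏ x ∈ S ∪ T, f x := by
    refine (Eq.trans ?_ n.prod_pow_factorization_centralBinom).symm
    apply Finset.prod_subset
    · intro x hx
      simp only [S, T, Finset.mem_union, Finset.mem_filter, Finset.mem_range,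
        Finset.mem_Ioc] at hx ⊢
      omega
    intro x hx h2x
    simp only [S, T, Finset.mem_union, Finset.mem_filter, Finset.mem_range,
      Finset.mem_Ioc] at hx h2x
    dsimp only [f]
    by_cases hxp : x.Prime
    · simp only [hxp, and_true] at h2x
      rw [Nat.factorization_centralBinom_of_two_mul_self_lt_three_mul n_large (by omega)
        (by omega), Nat.pow_zero]
    · rw [Nat.factorization_eq_zero_of_not_prime n.centralBinom hxp, Nat.pow_zero]
  have hf : ∀ p, f p ≤ 2 * n := fun p =>
    Nat.pow_factorization_choose_le (by omega)
  rw [hprod, Finset.prod_union hdisj, ←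
    Finset.prod_filter_mul_prod_filter_not S (· ≤ Nat.sqrt (2 * n))]
  refine mul_le_mul' (mul_le_mul' ?_ ?_) ?_
  · refine (Finset.prod_le_prod' fun p _ => hf p).trans ?_
    have : (Finset.Icc 1 (Nat.sqrt (2 * n))).card = Nat.sqrt (2 * n) := by
      rw [Nat.card_Icc, Nat.add_sub_cancel]
    rw [Finset.prod_const]
    refine pow_right_mono₀ n2_pos ((Finset.card_le_card fun x hx => ?_).trans this.le)
    obtain ⟨h1, h2⟩ := Finset.mem_filter.1 hx
    exact Finset.mem_Icc.mpr ⟨(Finset.mem_filter.1 h1).2.one_lt.le, h2⟩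
  · refine le_trans ?_ (primorial_le_four_pow (2 * n / 3))
    refine (Finset.prod_le_prod' fun p hp => (?_ : f p ≤ p)).trans ?_
    · obtain ⟨h1, h2⟩ := Finset.mem_filter.1 hp
      refine (pow_right_mono₀ (Finset.mem_filter.1 h1).2.one_lt.le ?_).trans (pow_one p).le
      exact Nat.factorization_choose_le_one (Nat.sqrt_lt'.mp <| not_le.1 h2)
    refine Finset.prod_le_prod_of_subset_of_one_le' (Finset.filter_subset _ _) ?_
    exact fun p hp _ => (Finset.mem_filter.1 hp).2.one_lt.le
  · refine (Finset.prod_le_prod' fun p _ => hf p).trans ?_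
    rw [Finset.prod_const]

theorem add_seven_mul_log_sq_le {t : ℝ} (ht : 45 ≤ t) :
    (t + 7) * Real.log (t ^ 2) ≤ t ^ 2 / 3 * Real.log 2 := by
  have hl := Real.log_two_gt_d9
  have hu := Real.log_two_lt_d9
  have hlog : Real.log t ≤ 6 * Real.log 2 + t / 64 - 1 := by
    have h := Real.log_le_sub_one_of_pos (show 0 < t / 64 by positivity)
    have h64 : Real.log 64 = 6 * Real.log 2 := by
      rw [show (64 : ℝ) = 2 ^ 6 by norm_num, Real.log_pow]; norm_num
    rw [Real.log_div (by positivity) (by norm_num), h64] at h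
    linarith
  have hlog' : Real.log t ≤ 3.1589 + t / 64 := by linarith
  rw [Real.log_pow]
  calc (t + 7) * ((2 : ℕ) * Real.log t) ≤ (t + 7) * (2 * (3.1589 + t / 64)) := by
        push_cast
        gcongr
    _ ≤ t ^ 2 / 3 * 0.69 := by nlinarith
    _ ≤ t ^ 2 / 3 * Real.log 2 := by gcongr; linarith

theorem two_mul_pow_sqrt_add_seven_mul_four_pow_le {m : ℕ} (hm : 1024 ≤ m) :
    (2 * m) ^ (Nat.sqrt (2 * m) + 7) * 4 ^ (2 * m / 3) ≤ 4 ^ m := by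
  have hm' : (1024 : ℝ) ≤ m := by exact_mod_cast hm
  have hsq : √(2 * (m : ℝ)) ^ 2 = 2 * m := Real.sq_sqrt (by positivity)
  have ht : 45 ≤ √(2 * (m : ℝ)) := Real.le_sqrt_of_sq_le (by linarith)
  have key := add_seven_mul_log_sq_le ht
  rw [hsq] at key
  have hs : (Nat.sqrt (2 * m) : ℝ) ≤ √(2 * (m : ℝ)) := by
    exact_mod_cast Real.nat_sqrt_le_real_sqrt (a := 2 * m)
  have hd : ((2 * m / 3 : ℕ) : ℝ) ≤ 2 * m / 3 := by
    exact_mod_cast Nat.cast_div_le (α := ℝ) (m := 2 * m) (n := 3)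
  have h4 : Real.log 4 = 2 * Real.log 2 := by
    rw [show (4 : ℝ) = 2 ^ 2 by norm_num, Real.log_pow]; norm_num
  have hl2 : 0 < Real.log 2 := Real.log_pos (by norm_num)
  have hly : 0 ≤ Real.log (2 * m) := Real.log_nonneg (by linarith)
  have hreal : (2 * (m : ℝ)) ^ (Nat.sqrt (2 * m) + 7) * 4 ^ (2 * m / 3) ≤ 4 ^ m := by
    rw [← Real.log_le_log_iff (by positivity) (by positivity),
      Real.log_mul (by positivity) (by positivity), Real.log_pow, Real.log_pow, Real.log_pow, h4]
    have h1 : ((Nat.sqrt (2 * m) + 7 : ℕ) : ℝ) * Real.log (2 * m) ≤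
        (√(2 * (m : ℝ)) + 7) * Real.log (2 * m) := by
      push_cast
      gcongr
    have h2 : ((2 * m / 3 : ℕ) : ℝ) * (2 * Real.log 2) ≤ 2 * m / 3 * (2 * Real.log 2) := by
      gcongr
    linarith
  exact_mod_cast hreal

theorem seven_le_card_bertrand_primes {m : ℕ} (hm : 1024 ≤ m) :
    7 ≤ ((Finset.Ioc m (2 * m)).filter Nat.Prime).card := by
  by_contra! hcard
  have hlt := Nat.four_pow_lt_mul_centralBinom m (by omega)
  refine hlt.not_ge ?_
  calc m * m.centralBinom
      ≤ (2 * m) * ((2 * m) ^ Nat.sqrt (2 * m) * 4 ^ (2 * m / 3) * (2 * m) ^ 6) := by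
        refine Nat.mul_le_mul (by omega)
          ((centralBinom_le_pow_card_bertrand_primes m (by omega)).trans ?_)
        exact Nat.mul_le_mul_left _ (Nat.pow_le_pow_right (by omega) (by omega))
    _ = (2 * m) ^ (Nat.sqrt (2 * m) + 7) * 4 ^ (2 * m / 3) := by ring
    _ ≤ 4 ^ m := two_mul_pow_sqrt_add_seven_mul_four_pow_le hm

theorem exists_seven_primes {n : ℕ} (hn : 79 ≤ n) :
    ∃ S : Finset ℕ, 7 ≤ S.card ∧ ∀ r ∈ S, r.Prime ∧ n < 2 * r ∧ r ≤ n := by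
  rcases lt_or_ge n 2048 with hlt | hge
  · have hwindow : ∀ S : Finset ℕ, 7 ≤ S.card → (∀ r ∈ S, r.Prime) →
        (∀ r ∈ S, n < 2 * r ∧ r ≤ n) →
        ∃ S : Finset ℕ, 7 ≤ S.card ∧ ∀ r ∈ S, r.Prime ∧ n < 2 * r ∧ r ≤ n :=
      fun S h7 hS hSn => ⟨S, h7, fun r hr => ⟨hS r hr, hSn r hr⟩⟩
    have hcases : n < 97 ∨ (97 ≤ n ∧ n < 131) ∨ (131 ≤ n ∧ n < 199) ∨ (199 ≤ n ∧ n < 337) ∨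
        (337 ≤ n ∧ n < 577) ∨ (577 ≤ n ∧ n < 1063) ∨ 1063 ≤ n := by omega
    rcases hcases with h | h | h | h | h | h | h
    · exact hwindow {53, 59, 61, 67, 71, 73, 79} (by decide) (by norm_num) (by simp; omega)
    · exact hwindow {67, 71, 73, 79, 83, 89, 97} (by decide) (by norm_num) (by simp; omega)
    · exact hwindow {101, 103, 107, 109, 113, 127, 131} (by decide) (by norm_num)
        (by simp; omega)
    · exact hwindow {173, 179, 181, 191, 193, 197, 199} (by decide) (by norm_num)
        (by simp; omega)
    · exact hwindow {293, 307, 311, 313, 317, 331, 337} (by decide) (by norm_num)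
        (by simp; omega)
    · exact hwindow {541, 547, 557, 563, 569, 571, 577} (by decide) (by norm_num)
        (by simp; omega)
    · exact hwindow {1031, 1033, 1039, 1049, 1051, 1061, 1063} (by decide) (by norm_num)
        (by simp; omega)
  · refine ⟨_, seven_le_card_bertrand_primes (m := n / 2) (by omega), fun r hr => ?_⟩
    simp only [Finset.mem_filter, Finset.mem_Ioc] at hr
    exact ⟨hr.2, by omega, by omega⟩

theorem one_lt_card_good_primes_of_lt : ∀ n ∈ Finset.Ico 26 79, n ≠ 27 →
    ∀ p ∈ Finset.range (n - 2), p.Prime → (∀ q ∈ Finset.Ioc p n, ¬ q.Prime) →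
    1 < ((Finset.Ioo (n / 2) p).filter fun r =>
      r.Prime ∧ n - r ≠ 3 ∧ n - r ≠ 4 ∧ n - r ≠ 6 ∧ n - r ≠ 10).card := by
  decide +kernel

theorem two_good_primes
    (n p : ℕ) (hn : 26 ≤ n) (h27 : n ≠ 27)
    (hp : p.Prime) (hpn : p ≤ n)
    (hmax : ∀ q : ℕ, q.Prime → q ≤ n → q ≤ p)
    (hnp : 2 < n - p) :
    ∃ r₁ r₂ : ℕ, r₁ ≠ r₂ ∧ r₁.Prime ∧ r₂.Prime ∧
      2 * r₁ > n ∧ r₁ < p ∧ 2 * r₂ > n ∧ r₂ < p ∧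
      n - r₁ ∉ ({3, 4, 6, 10} : Set ℕ) ∧ n - r₂ ∉ ({3, 4, 6, 10} : Set ℕ) := by
  simp only [Set.mem_insert_iff, Set.mem_singleton_iff, not_or]
  rcases lt_or_ge n 79 with hlt | hge
  · obtain ⟨r₁, h1, r₂, h2, hne⟩ := Finset.one_lt_card.1 <|
      one_lt_card_good_primes_of_lt n (Finset.mem_Ico.2 ⟨hn, hlt⟩) h27 p
        (Finset.mem_range.2 (by omega)) hp fun q hq hqp =>
          (Finset.mem_Ioc.1 hq).1.not_ge (hmax q hqp (Finset.mem_Ioc.1 hq).2)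
    simp only [Finset.mem_filter, Finset.mem_Ioo] at h1 h2
    exact ⟨r₁, r₂, hne, h1.2.1, h2.2.1, by omega, h1.1.2, by omega, h2.1.2, h1.2.2, h2.2.2⟩
  · obtain ⟨S, hS, hSr⟩ := exists_seven_primes hge
    let B : Finset ℕ := {p, n - 3, n - 4, n - 6, n - 10}
    have hB : B.card ≤ 5 := Finset.card_le_five
    have hSB : 1 < (S \ B).card := by
      have := Finset.le_card_sdiff B S
      omega
    obtain ⟨r₁, h1, r₂, h2, hne⟩ := Finset.one_lt_card.1 hSB
    have hgood : ∀ r ∈ S \ B, r.Prime ∧ 2 * r > n ∧ r < p ∧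
        (n - r ≠ 3 ∧ n - r ≠ 4 ∧ n - r ≠ 6 ∧ n - r ≠ 10) := by
      intro r hr
      simp only [B, Finset.mem_sdiff, Finset.mem_insert, Finset.mem_singleton] at hr
      obtain ⟨hrp, hrn, hrle⟩ := hSr r hr.1
      have := hmax r hrp hrle
      exact ⟨hrp, hrn, by omega, by omega⟩
    obtain ⟨h1p, h1n, h1lt, hr₁⟩ := hgood r₁ h1
    obtain ⟨h2p, h2n, h2lt, hr₂⟩ := hgood r₂ h2
    exact ⟨r₁, r₂, hne, h1p, h2p, h1n, h1lt, h2n, h2lt, hr₁, hr₂⟩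
end

section
/- Let n ≥ 5, let r be a prime with n/2 < r ≤ n, and let G be a finite group with ω(G) = ω(A_n) whose Sylow r-subgroups are cyclic of order r. If y ∈ G has order r and x ∈ A_n has order r, then the spectra of the centralizers coincide: ω(C_G(y)) = ω(C_{A_n}(x)). -/
/-- If the Sylow `r`-subgroups have order `r`, every element of order `r` generates one. -/
theorem exists_sylow_eq_zpowers {H : Type*} [Group H] [Finite H] {r : ℕ} (hr : r.Prime)
    (hsyl : ∀ P : Sylow r H, Nat.card P = r) {y : H} (hy : orderOf y = r) :
    ∃ P : Sylow r H, (P : Subgroup H) = Subgroup.zpowers y := by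
  have : Fact r.Prime := ⟨hr⟩
  have hcard : Nat.card (Subgroup.zpowers y) = r := by rw [Nat.card_zpowers, hy]
  have hp : IsPGroup r (Subgroup.zpowers y) := IsPGroup.of_card (n := 1) (by rw [hcard, pow_one])
  obtain ⟨P, hP⟩ := hp.exists_le_sylow
  exact ⟨P, (Subgroup.eq_of_le_of_card_ge hP (by rw [hcard]; exact (hsyl P).le)).symm⟩

/-- If the Sylow `r`-subgroups have order `r`, the spectrum of the centralizer of an element of
order `r` is determined by the spectrum of the whole group. -/
theorem mem_groupSpectrum_centralizer_iff {H : Type*} [Group H] [Finite H] {r : ℕ}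
    (hr : r.Prime) (hsyl : ∀ P : Sylow r H, Nat.card P = r) {y : H} (hy : orderOf y = r) (k : ℕ) :
    k ∈ groupSpectrum (Subgroup.centralizer {y}) ↔ k.lcm r ∈ groupSpectrum H := by
  have : Fact r.Prime := ⟨hr⟩
  constructor
  · rintro ⟨⟨g, hg⟩, hk⟩
    rw [Subgroup.orderOf_mk] at hk
    by_cases hrk : r ∣ k
    · exact ⟨g, by rw [hk, Nat.lcm_eq_left hrk]⟩
    · have hcop : Nat.Coprime k r := ((Nat.Prime.coprime_iff_not_dvd hr).2 hrk).symm
      have hcomm : Commute g y := (Subgroup.mem_centralizer_singleton_iff.1 hg)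
      refine ⟨g * y, ?_⟩
      rw [hcomm.orderOf_mul_eq_mul_orderOf_of_coprime (by rwa [hk, hy]), hk, hy, hcop.lcm_eq_mul]
  · rintro ⟨h, hh⟩
    have hpos : orderOf h ≠ 0 := (orderOf_pos h).ne'
    have hrh : r ∣ orderOf h := hh ▸ Nat.dvd_lcm_right k r
    have hkh : k ∣ orderOf h := hh ▸ Nat.dvd_lcm_left k r
    have hz : orderOf (h ^ (orderOf h / r)) = r := orderOf_pow_orderOf_div hpos hrh
    obtain ⟨P, hP⟩ := exists_sylow_eq_zpowers hr hsyl hz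
    obtain ⟨Q, hQ⟩ := exists_sylow_eq_zpowers hr hsyl hy
    obtain ⟨c, hc⟩ := MulAction.exists_smul_eq H P Q
    have hyc : y ∈ ((c • P : Sylow r H) : Subgroup H) := by
      rw [hc, hQ]
      exact Subgroup.mem_zpowers y
    have hyc' : c⁻¹ * y * c ∈ (P : Subgroup H) := by
      rw [Sylow.coe_subgroup_smul,
        Subgroup.mem_pointwise_smul_iff_inv_smul_mem] at hyc
      simpa [MulAut.conj_inv_apply, MulAut.smul_def, ← map_inv] using hyc
    rw [hP] at hyc'
    obtain ⟨m, hm⟩ := Subgroup.mem_zpowers_iff.1 hyc'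
    have hcomm : Commute h (c⁻¹ * y * c) := hm ▸ ((Commute.refl h).pow_right _).zpow_right _
    have hcomm' : Commute (c * h * c⁻¹) y := by
      have := hcomm.map (MulAut.conj c)
      simpa [MulAut.conj_apply, mul_assoc] using this
    have hord : orderOf (c * h * c⁻¹) = orderOf h := by
      simpa using MulEquiv.orderOf_eq (MulAut.conj c) h
    refine ⟨⟨(c * h * c⁻¹) ^ (orderOf h / k), ?_⟩, ?_⟩
    · exact Subgroup.mem_centralizer_singleton_iff.2 (hcomm'.pow_left _)
    · rw [Subgroup.orderOf_mk, ← hord]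
      exact orderOf_pow_orderOf_div (hord ▸ hpos) (hord ▸ hkh)

/-- If `r` divides the order of a group but `r ^ 2` does not, its Sylow `r`-subgroups have
order `r`. -/
theorem card_sylow_eq_of_not_sq_dvd {H : Type*} [Group H] [Finite H] {r : ℕ} (hr : r.Prime)
    (hdvd : r ∣ Nat.card H) (hsq : ¬ r ^ 2 ∣ Nat.card H) (P : Sylow r H) : Nat.card P = r := by
  have : Fact r.Prime := ⟨hr⟩
  have h0 : Nat.card H ≠ 0 := Nat.card_pos.ne'
  rw [P.card_eq_multiplicity]
  have h1 := (hr.dvd_iff_one_le_factorization h0).1 hdvd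
  have h2 := mt (hr.pow_dvd_iff_le_factorization h0).2 hsq
  rw [show (Nat.card H).factorization r = 1 by lia, pow_one]

theorem not_sq_dvd_factorial {n r : ℕ} (hr : r.Prime) (h1 : 2 * r > n) : ¬ r ^ 2 ∣ n.factorial := by
  have hr2 := hr.two_le
  have hlog : Nat.log r n < 2 := Nat.log_lt_of_lt_pow' (by norm_num) (by nlinarith)
  rw [hr.pow_dvd_factorial_iff hlog]
  have : n / r < 2 := Nat.div_lt_of_lt_mul (by lia)
  simpa using this

theorem spectrum_centralizer_eq
    (n r : ℕ) (hn : 5 ≤ n) (hr : r.Prime) (h1 : 2 * r > n) (h2 : r ≤ n)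
    (G : Type*) [Group G] [Finite G]
    (hspec : groupSpectrum G = groupSpectrum (alternatingGroup (Fin n)))
    (hsyl : ∀ P : Sylow r G, Nat.card P = r)
    (y : G) (hy : orderOf y = r)
    (x : alternatingGroup (Fin n)) (hx : orderOf x = r) :
    groupSpectrum (Subgroup.centralizer {y}) =
      groupSpectrum (Subgroup.centralizer {x}) := by
  have hcard : Nat.card (alternatingGroup (Fin n)) ∣ n.factorial := by
    have h := Subgroup.card_subgroup_dvd_card (alternatingGroup (Fin n))
    rwa [Nat.card_perm, Nat.card_fin] at h
  have hsylA := card_sylow_eq_of_not_sq_dvd hr (hx ▸ orderOf_dvd_natCard x)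
    fun h => not_sq_dvd_factorial hr h1 (h.trans hcard)
  ext k
  rw [mem_groupSpectrum_centralizer_iff hr hsyl hy, mem_groupSpectrum_centralizer_iff hr hsylA hx,
    hspec]
end

section
/- Let n ≥ 5, let r be a prime with n/2 < r < n - 2, and let G be a finite group with ω(G) = ω(A_n) whose Sylow r-subgroups are cyclic of order r. If y ∈ G has order r, then the centralizer C_G(y) decomposes as a direct product C_G(y) = ⟨y⟩ × M, where M is a group whose spectrum equals the spectrum of the alternating group A_{n-r}; that is, there is a group M with ω(M) = ω(A_{n-r}) and a group isomorphism C_G(y) ≅ (ℤ/rℤ) × M. -/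
lemma mem_groupSpectrum_alternatingGroup_iff {n k : ℕ} :
    k ∈ groupSpectrum (alternatingGroup (Fin n)) ↔
      ∃ s : Multiset ℕ, s.sum ≤ n ∧ (∀ a ∈ s, 2 ≤ a) ∧
        (-1 : ℤˣ) ^ (s.sum + s.card) = 1 ∧ s.lcm = k := by
  constructor
  · rintro ⟨⟨g, hg⟩, rfl⟩
    refine ⟨g.cycleType, ?_, fun a ha => Equiv.Perm.two_le_of_mem_cycleType ha, ?_, ?_⟩
    · have h := (Equiv.Perm.exists_with_cycleType_iff (Fin n)).1 ⟨g, rfl⟩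
      simpa using h.1
    · rw [← Equiv.Perm.sign_of_cycleType]
      exact Equiv.Perm.mem_alternatingGroup.1 hg
    · rw [Equiv.Perm.lcm_cycleType, Subgroup.orderOf_mk]
  · rintro ⟨s, hs, h2, hsign, rfl⟩
    obtain ⟨g, rfl⟩ := (Equiv.Perm.exists_with_cycleType_iff (Fin n)).2
      ⟨by simpa using hs, h2⟩
    rw [← Equiv.Perm.sign_of_cycleType] at hsign
    exact ⟨⟨g, Equiv.Perm.mem_alternatingGroup.2 hsign⟩, by
      rw [Equiv.Perm.lcm_cycleType, Subgroup.orderOf_mk]⟩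

lemma Nat.Prime.exists_mem_dvd_of_dvd_multiset_lcm {p : ℕ} (hp : p.Prime) {s : Multiset ℕ}
    (h : p ∣ s.lcm) : ∃ a ∈ s, p ∣ a :=
  hp.prime.exists_mem_multiset_dvd
    (h.trans (Multiset.lcm_dvd.2 fun _ ha => Multiset.dvd_prod ha))

lemma Nat.Prime.coprime_multiset_lcm_of_sum_lt {p : ℕ} (hp : p.Prime) {s : Multiset ℕ}
    (hs : s.sum < p) (hpos : ∀ a ∈ s, 2 ≤ a) : p.Coprime s.lcm := by
  refine hp.coprime_iff_not_dvd.2 fun h => ?_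
  obtain ⟨a, ha, hpa⟩ := hp.exists_mem_dvd_of_dvd_multiset_lcm h
  have := Nat.le_of_dvd (by have := hpos a ha; lia) hpa
  have := Multiset.le_sum_of_mem ha
  lia

lemma neg_one_pow_add_card_cons {r : ℕ} (hr : Odd r) (s : Multiset ℕ) :
    (-1 : ℤˣ) ^ ((r ::ₘ s).sum + (r ::ₘ s).card) = (-1 : ℤˣ) ^ (s.sum + s.card) := by
  rw [Multiset.sum_cons, Multiset.card_cons,
    show r + s.sum + (s.card + 1) = (r + 1) + (s.sum + s.card) by ring, pow_add,
    hr.add_one.neg_one_pow, one_mul]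

lemma coprime_of_mem_groupSpectrum_alternatingGroup {n p m : ℕ} (hp : p.Prime) (hnp : n < p)
    (hm : m ∈ groupSpectrum (alternatingGroup (Fin n))) : p.Coprime m := by
  obtain ⟨s, hs, h2, -, rfl⟩ := mem_groupSpectrum_alternatingGroup_iff.1 hm
  exact hp.coprime_multiset_lcm_of_sum_lt (hs.trans_lt hnp) h2

lemma prime_mul_mem_groupSpectrum_alternatingGroup_iff {n r m : ℕ} (hr : r.Prime)
    (hodd : Odd r) (hrn : r ≤ n) (hnr : n < 2 * r) :
    r * m ∈ groupSpectrum (alternatingGroup (Fin n)) ↔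
      m ∈ groupSpectrum (alternatingGroup (Fin (n - r))) := by
  simp only [mem_groupSpectrum_alternatingGroup_iff]
  constructor
  · rintro ⟨s, hs, h2, hsign, hlcm⟩
    obtain ⟨a, ha, c, rfl⟩ := hr.exists_mem_dvd_of_dvd_multiset_lcm (hlcm ▸ dvd_mul_right r m)
    have h2a := h2 _ ha
    have hle := Multiset.le_sum_of_mem ha
    obtain rfl : c = 1 := by
      have h0 : c ≠ 0 := by rintro rfl; simp at h2a
      have : c < 2 := by
        by_contra! hc
        have := Nat.mul_le_mul_left r hc
        lia
      lia
    rw [mul_one] at ha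
    obtain ⟨t, rfl⟩ := Multiset.exists_cons_of_mem ha
    have h2t : ∀ a ∈ t, 2 ≤ a := fun a ha => h2 a (Multiset.mem_cons_of_mem ha)
    rw [neg_one_pow_add_card_cons hodd] at hsign
    rw [Multiset.sum_cons] at hs
    have hco := hr.coprime_multiset_lcm_of_sum_lt (show t.sum < r by lia) h2t
    refine ⟨t, by lia, h2t, hsign, ?_⟩
    rw [Multiset.lcm_cons] at hlcm
    exact Nat.eq_of_mul_eq_mul_left hr.pos (hco.lcm_eq_mul.symm.trans hlcm)
  · rintro ⟨t, ht, h2, hsign, rfl⟩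
    refine ⟨r ::ₘ t, by rw [Multiset.sum_cons]; lia, ?_, ?_, ?_⟩
    · intro a ha
      rcases Multiset.mem_cons.1 ha with rfl | ha
      exacts [hr.two_le, h2 a ha]
    · rwa [neg_one_pow_add_card_cons hodd]
    · rw [Multiset.lcm_cons]
      exact (hr.coprime_multiset_lcm_of_sum_lt (by lia) h2).lcm_eq_mul

/-- A central subgroup of order coprime to its index is a direct factor. -/
lemma Subgroup.exists_mulEquiv_prod_of_le_center {C : Type*} [Group C] [Finite C]
    (P : Subgroup C) (hP : P ≤ Subgroup.center C) (hco : (Nat.card P).Coprime P.index) :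
    ∃ H : Subgroup C, Nonempty (C ≃* P × H) := by
  have : P.Normal := ⟨fun n hn g => by
    rwa [Subgroup.mem_center_iff.1 (hP hn) g, mul_inv_cancel_right]⟩
  obtain ⟨H, hH⟩ := Subgroup.exists_right_complement'_of_coprime hco
  refine ⟨H, ⟨(MulEquiv.ofBijective (P.subtype.noncommCoprod H.subtype fun p h =>
    (Subgroup.mem_center_iff.1 (hP p.2) h).symm) ?_).symm⟩⟩
  exact hH

lemma Sylow.not_sq_dvd_card_of_card_eq {G : Type*} [Group G] [Finite G] {r : ℕ} (hr : r.Prime)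
    (hsyl : ∀ P : Sylow r G, Nat.card P = r) : ¬ r ^ 2 ∣ Nat.card G := by
  have : Fact r.Prime := ⟨hr⟩
  intro h
  have hc := hsyl default
  rw [Sylow.card_eq_multiplicity] at hc
  have hf : (Nat.card G).factorization r = 1 :=
    Nat.pow_right_injective hr.two_le (by simpa using hc)
  have := (hr.pow_dvd_iff_le_factorization Nat.card_pos.ne').1 h
  lia

/-- If the Sylow `r`-subgroups have order `r`, then any two elements of order `r` generate
conjugate subgroups. -/
lemma exists_conj_zpowers_eq {G : Type*} [Group G] [Finite G] {r : ℕ} (hr : r.Prime)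
    (hsyl : ∀ P : Sylow r G, Nat.card P = r) {x y : G} (hx : orderOf x = r)
    (hy : orderOf y = r) :
    ∃ g : G, (Subgroup.zpowers x).map (MulAut.conj g).toMonoidHom = Subgroup.zpowers y := by
  have : Fact r.Prime := ⟨hr⟩
  have key : ∀ z : G, orderOf z = r → ∃ P : Sylow r G, (P : Subgroup G) = Subgroup.zpowers z := by
    intro z hz
    have hp : IsPGroup r (Subgroup.zpowers z) :=
      IsPGroup.of_card (n := 1) (by rw [Nat.card_zpowers, hz, pow_one])
    obtain ⟨P, hP⟩ := hp.exists_le_sylow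
    refine ⟨P, (Subgroup.eq_of_le_of_card_ge hP ?_).symm⟩
    rw [Nat.card_zpowers, hz]
    exact (hsyl P).le
  obtain ⟨P, hP⟩ := key x hx
  obtain ⟨Q, hQ⟩ := key y hy
  obtain ⟨g, rfl⟩ := MulAction.exists_smul_eq G P Q
  exact ⟨g, by rw [← hP, ← hQ]; rfl⟩

/-- If the Sylow `r`-subgroups of `G` have order `r` and `G` has an element of order `r * m`, then
the centralizer of any element of order `r` has an element of order `m`. -/
lemma mem_groupSpectrum_centralizer {G : Type*} [Group G] [Finite G] {r m : ℕ} (hr : r.Prime)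
    (hsyl : ∀ P : Sylow r G, Nat.card P = r) {y : G} (hy : orderOf y = r)
    (h : r * m ∈ groupSpectrum G) : m ∈ groupSpectrum (Subgroup.centralizer {y}) := by
  obtain ⟨g, hg⟩ := h
  have hm : m ≠ 0 := by
    rintro rfl
    exact (orderOf_pos g).ne' (by simpa using hg)
  have hgm : orderOf (g ^ m) = r := by
    rw [orderOf_pow_of_dvd hm (hg ▸ dvd_mul_left m r), hg, Nat.mul_div_cancel _ (by lia)]
  have hgr : orderOf (g ^ r) = m := by
    rw [orderOf_pow_of_dvd hr.ne_zero (hg ▸ dvd_mul_right r m), hg,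
      Nat.mul_div_cancel_left _ hr.pos]
  obtain ⟨c, hc⟩ := exists_conj_zpowers_eq hr hsyl hgm hy
  obtain ⟨z, ⟨k, rfl⟩, hz⟩ : y ∈ (Subgroup.zpowers (g ^ m)).map (MulAut.conj c).toMonoidHom :=
    hc ▸ Subgroup.mem_zpowers y
  have hcomm : Commute (MulAut.conj c (g ^ r)) y := by
    rw [← hz]
    exact (((Commute.refl g).pow_pow r m).zpow_right k).map (MulAut.conj c)
  refine ⟨⟨MulAut.conj c (g ^ r), Subgroup.mem_centralizer_singleton_iff.2 hcomm⟩, ?_⟩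
  rw [Subgroup.orderOf_mk, MulEquiv.orderOf_eq, hgr]

/-- If the Sylow `r`-subgroups of `G` have order `r`, then the centralizer of an element of order
`r` has a direct factor of order `r`, with complement of order prime to `r`. -/
lemma exists_centralizer_mulEquiv_prod {G : Type*} [Group G] [Finite G] {r : ℕ} (hr : r.Prime)
    (hsyl : ∀ P : Sylow r G, Nat.card P = r) {y : G} (hy : orderOf y = r) :
    ∃ (M : Type) (_ : Group M) (_ : Finite M), r.Coprime (Nat.card M) ∧
      Nonempty (Subgroup.centralizer {y} ≃* Multiplicative (ZMod r) × M) := by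
  have : Fact r.Prime := ⟨hr⟩
  let c : Subgroup.centralizer {y} := ⟨y, Subgroup.mem_centralizer_singleton_iff.2 rfl⟩
  have hc : Nat.card (Subgroup.zpowers c) = r := by
    rw [Nat.card_zpowers, Subgroup.orderOf_mk, hy]
  have hcenter : Subgroup.zpowers c ≤ Subgroup.center _ := by
    rw [Subgroup.zpowers_le, Subgroup.mem_center_iff]
    exact fun g => Subtype.ext (Subgroup.mem_centralizer_singleton_iff.1 g.2)
  have hco : r.Coprime (Subgroup.zpowers c).index := by
    refine hr.coprime_iff_not_dvd.2 fun h => Sylow.not_sq_dvd_card_of_card_eq hr hsyl ?_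
    refine dvd_trans ?_ (Subgroup.card_subgroup_dvd_card (Subgroup.centralizer {y}))
    rw [← (Subgroup.zpowers c).card_mul_index, hc, sq]
    exact mul_dvd_mul_left r h
  obtain ⟨H, ⟨e⟩⟩ := (Subgroup.zpowers c).exists_mulEquiv_prod_of_le_center hcenter
    (by rwa [hc])
  refine ⟨Shrink.{0} H, inferInstance, inferInstance, ?_, ⟨e.trans (MulEquiv.prodCongr
    (mulEquivOfPrimeCardEq (p := r) hc (by simp)) (Shrink.mulEquiv : Shrink.{0} H ≃* H).symm)⟩⟩
  have hcard : Nat.card H = (Subgroup.zpowers c).index := by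
    have h := Nat.card_congr e.toEquiv
    rw [Nat.card_prod, ← (Subgroup.zpowers c).card_mul_index, hc] at h
    exact (Nat.eq_of_mul_eq_mul_left hr.pos h).symm
  rwa [Nat.card_congr (Shrink.mulEquiv : Shrink.{0} H ≃* H).toEquiv, hcard]

lemma mem_groupSpectrum_of_prod {A M : Type*} [Group A] [Group M] {m : ℕ}
    (hco : (Nat.card A).Coprime m) (h : m ∈ groupSpectrum (A × M)) : m ∈ groupSpectrum M := by
  obtain ⟨⟨a, x⟩, hx⟩ := h
  rw [Prod.orderOf_mk] at hx
  have ha : orderOf a = 1 :=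
    Nat.eq_one_of_dvd_coprimes hco (orderOf_dvd_natCard a) (hx ▸ Nat.dvd_lcm_left _ _)
  exact ⟨x, by simpa [ha] using hx⟩

theorem centralizer_decomposition
    (n r : ℕ) (hn : 5 ≤ n) (hr : r.Prime) (h1 : 2 * r > n) (h2 : r < n - 2)
    (G : Type*) [Group G] [Finite G]
    (hspec : groupSpectrum G = groupSpectrum (alternatingGroup (Fin n)))
    (hsyl : ∀ P : Sylow r G, Nat.card P = r)
    (y : G) (hy : orderOf y = r) :
    ∃ (M : Type) (_ : Group M) (_ : Finite M),
      groupSpectrum M = groupSpectrum (alternatingGroup (Fin (n - r))) ∧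
      Nonempty (Subgroup.centralizer {y} ≃* Multiplicative (ZMod r) × M) := by
  have hodd : Odd r := hr.odd_of_ne_two (by lia)
  obtain ⟨M, hM, hfin, hco, ⟨e⟩⟩ := exists_centralizer_mulEquiv_prod hr hsyl hy
  refine ⟨M, hM, hfin, ?_, ⟨e⟩⟩
  ext m
  have key := prime_mul_mem_groupSpectrum_alternatingGroup_iff (m := m) hr hodd (by lia) h1
  rw [← hspec] at key
  constructor
  · rintro ⟨x, rfl⟩
    refine key.1 ⟨(e.symm (Multiplicative.ofAdd 1, x) : G), ?_⟩
    rw [Subgroup.orderOf_coe, MulEquiv.orderOf_eq, Prod.orderOf_mk, orderOf_ofAdd_eq_addOrderOf,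
      ZMod.addOrderOf_one]
    exact (hco.coprime_dvd_right (orderOf_dvd_natCard x)).lcm_eq_mul
  · intro hm
    have hrm := coprime_of_mem_groupSpectrum_alternatingGroup hr (by lia) hm
    obtain ⟨x, hx⟩ := mem_groupSpectrum_centralizer hr hsyl hy (key.2 hm)
    exact mem_groupSpectrum_of_prod (A := Multiplicative (ZMod r)) ((Nat.card_zmod r).symm ▸ hrm)
      ⟨e x, by rw [MulEquiv.orderOf_eq, hx]⟩
end

section
/- Let n be a natural number and let r and s be two distinct primes with 2r > n and 2s > n. Then the product r*s does not belong to the spectrum of the alternating group A_n; that is, A_n has no element of order r*s. -/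
theorem Equiv.Perm.exists_mem_cycleType_of_prime_dvd_orderOf {α : Type*} [Fintype α]
    [DecidableEq α] {σ : Equiv.Perm α} {p : ℕ} (hp : p.Prime) (h : p ∣ orderOf σ) :
    ∃ m ∈ σ.cycleType, p ∣ m := by
  rw [← σ.lcm_cycleType] at h
  exact hp.prime.exists_mem_multiset_dvd
    (h.trans (Multiset.lcm_dvd.mpr fun _ hm => Multiset.dvd_prod hm))

theorem Equiv.Perm.add_le_card_of_mem_cycleType {α : Type*} [Fintype α] [DecidableEq α]
    {σ : Equiv.Perm α} {a b : ℕ} (ha : a ∈ σ.cycleType) (hb : b ∈ σ.cycleType) (hab : a ≠ b) :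
    a + b ≤ Fintype.card α := by
  obtain ⟨t, ht⟩ := Multiset.exists_cons_of_mem ha
  rw [ht] at hb
  have hbt : b ∈ t := (Multiset.mem_cons.mp hb).resolve_left hab.symm
  have hle := σ.sum_cycleType_le
  rw [ht, Multiset.sum_cons] at hle
  exact (Nat.add_le_add_left (Multiset.le_sum_of_mem hbt) a).trans hle

theorem no_element_of_order_mul_large_primes
    (n r s : ℕ) (hr : r.Prime) (hs : s.Prime) (hrs : r ≠ s)
    (h1 : 2 * r > n) (h2 : 2 * s > n) :
    ¬ ∃ g : alternatingGroup (Fin n), orderOf g = r * s := by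
  rintro ⟨g, hg⟩
  rw [← Subgroup.orderOf_coe] at hg
  obtain ⟨a, ha, hra⟩ := Equiv.Perm.exists_mem_cycleType_of_prime_dvd_orderOf hr
    (hg ▸ dvd_mul_right r s)
  obtain ⟨b, hb, hsb⟩ := Equiv.Perm.exists_mem_cycleType_of_prime_dvd_orderOf hs
    (hg ▸ dvd_mul_left s r)
  have ha0 : 0 < a := two_pos.trans_le (Equiv.Perm.two_le_of_mem_cycleType ha)
  have hb0 : 0 < b := two_pos.trans_le (Equiv.Perm.two_le_of_mem_cycleType hb)
  have hle_a := Nat.le_of_dvd ha0 hra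
  have hle_b := Nat.le_of_dvd hb0 hsb
  by_cases hab : a = b
  · subst hab
    have hdvd := ((Nat.coprime_primes hr hs).mpr hrs).mul_dvd_of_dvd_of_dvd hra hsb
    have hle := Nat.le_of_dvd ha0 hdvd
    have han : a ≤ n := by
      simpa using (Equiv.Perm.le_card_support_of_mem_cycleType ha).trans (Finset.card_le_univ _)
    have := Nat.mul_le_mul_left r hs.two_le
    omega
  · have := Equiv.Perm.add_le_card_of_mem_cycleType ha hb hab
    rw [Fintype.card_fin] at this
    omega
end

section
/- For every natural number n ≥ 42, there exist at least four primes r with n/2 < r < p, where p denotes the largest prime not exceeding n; that is, the set {r : ℕ | r prime, 2*r > n, r < p} has cardinality at least 4. -/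
open Finset in
/-- The primes in `(n, 2n]` contribute at most `2n` each to the central binomial coefficient, those
below `√(2n)` at most `2n` each, and the remaining ones at most `4 ^ (2n / 3)` altogether. -/
theorem centralBinom_le_pow_card_primes_Ioc {n : ℕ} (hn : 2 < n) :
    n.centralBinom ≤
      (2 * n) ^ (#{p ∈ Ioc n (2 * n) | p.Prime} + Nat.sqrt (2 * n)) * 4 ^ (2 * n / 3) := by
  let f (p : ℕ) := p ^ n.centralBinom.factorization p
  have hf (p : ℕ) : f p ≤ 2 * n := Nat.pow_factorization_choose_le (by lia)
  let S := {p ∈ range (2 * n / 3 + 1) | p.Prime}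
  let T := {p ∈ Ioc n (2 * n) | p.Prime}
  have hST : Disjoint T S := by
    rw [disjoint_left]
    intro p hp hp'
    simp only [S, T, mem_filter, mem_Ioc, mem_range] at hp hp'
    lia
  have hprod : ∏ p ∈ T ∪ S, f p = n.centralBinom := by
    rw [← n.prod_pow_factorization_centralBinom]
    refine prod_subset (fun p hp ↦ ?_) fun p hp hp' ↦ ?_
    · simp only [S, T, mem_union, mem_filter, mem_Ioc, mem_range] at hp ⊢
      lia
    · by_cases hpp : p.Prime
      · simp only [S, T, mem_union, mem_filter, mem_Ioc, mem_range, hpp, and_true] at hp hp'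
        simp only [f]
        rw [Nat.factorization_centralBinom_of_two_mul_self_lt_three_mul hn (by lia) (by lia),
          pow_zero]
      · simp only [f]
        rw [Nat.factorization_eq_zero_of_not_prime _ hpp, pow_zero]
  rw [← hprod, prod_union hST, pow_add, mul_assoc]
  refine mul_le_mul' (prod_le_pow_card _ _ _ fun p _ ↦ hf p) ?_
  rw [← prod_filter_mul_prod_filter_not S (· ≤ Nat.sqrt (2 * n))]
  refine mul_le_mul' ?_ ?_
  · refine (prod_le_pow_card _ _ _ fun p _ ↦ hf p).trans (Nat.pow_le_pow_right (by lia) ?_)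
    refine (card_le_card (t := Icc 1 (Nat.sqrt (2 * n))) fun p hp ↦ ?_).trans_eq (by simp)
    simp only [S, mem_filter] at hp
    exact mem_Icc.mpr ⟨hp.1.2.one_le, hp.2⟩
  · refine le_trans ?_ (primorial_le_four_pow (2 * n / 3))
    calc ∏ p ∈ S with ¬ p ≤ Nat.sqrt (2 * n), f p
        ≤ ∏ p ∈ S with ¬ p ≤ Nat.sqrt (2 * n), p := by
          refine prod_le_prod' fun p hp ↦ ?_
          simp only [S, mem_filter, not_le] at hp
          refine (Nat.pow_le_pow_right hp.1.2.pos ?_).trans_eq (pow_one p)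
          exact Nat.factorization_choose_le_one (Nat.sqrt_lt'.mp hp.2)
      _ ≤ primorial (2 * n / 3) :=
          prod_le_prod_of_subset_of_one_le' (filter_subset _ _)
            fun p hp _ ↦ (mem_filter.mp hp).2.one_le

theorem mul_pow_four_add_sqrt_mul_four_pow_le {n : ℕ} (hn : 1024 ≤ n) :
    n * ((2 * n) ^ (4 + Nat.sqrt (2 * n)) * 4 ^ (2 * n / 3)) ≤ 4 ^ n := by
  have hn' : (1024 : ℝ) ≤ n := by exact_mod_cast hn
  set s : ℝ := √(2 * n) with hs
  have hs2 : s ^ 2 = 2 * n := Real.sq_sqrt (by positivity)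
  have hs45 : 45 ≤ s := Real.le_sqrt_of_sq_le (by linarith)
  have hlogs : Real.log s ≤ s / 64 + 6 * Real.log 2 - 1 := by
    have h := Real.log_le_sub_one_of_pos (show 0 < s / 64 by positivity)
    rw [Real.log_div (by positivity) (by norm_num),
      show (64 : ℝ) = 2 ^ 6 by norm_num, Real.log_pow] at h
    norm_num at h
    linarith
  have hlog2n : Real.log (2 * n) = 2 * Real.log s := by
    rw [← hs2, Real.log_pow]
    norm_num
  have hlog4 : Real.log 4 = 2 * Real.log 2 := by
    rw [show (4 : ℝ) = 2 ^ 2 by norm_num, Real.log_pow]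
    norm_num
  have hlogn : Real.log n ≤ 2 * Real.log s := by
    rw [← hlog2n]
    exact Real.log_le_log (by positivity) (by linarith)
  have hsqrt : (Nat.sqrt (2 * n) : ℝ) ≤ s := by
    simpa [hs] using Real.nat_sqrt_le_real_sqrt (a := 2 * n)
  have hdiv : ((2 * n / 3 : ℕ) : ℝ) ≤ s ^ 2 / 3 := by
    rw [hs2]
    simpa using Nat.cast_div_le (α := ℝ) (m := 2 * n) (n := 3)
  have hlog2 := Real.log_two_gt_d9
  have hlog2' := Real.log_two_lt_d9
  have hlogs0 : 0 ≤ Real.log s := Real.log_nonneg (by linarith)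
  have key : (s + 5) * Real.log s ≤ s ^ 2 * Real.log 2 / 6 := by
    have h₁ : (s + 5) * Real.log s ≤ (s + 5) * (s / 64 + 3.16) := by
      gcongr
      linarith
    have h₂ : s ^ 2 * 0.69 ≤ s ^ 2 * Real.log 2 := by
      gcongr
      linarith
    nlinarith
  rw [← Nat.cast_le (α := ℝ)]
  push_cast
  rw [← Real.log_le_log_iff (by positivity) (by positivity), Real.log_mul (by positivity)
    (by positivity), Real.log_mul (by positivity) (by positivity), Real.log_pow, Real.log_pow,
    Real.log_pow, hlog2n, hlog4]
  have h₁ : ((4 + Nat.sqrt (2 * n) : ℕ) : ℝ) * (2 * Real.log s) ≤ (4 + s) * (2 * Real.log s) := by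
    push_cast
    gcongr
  have h₂ : ((2 * n / 3 : ℕ) : ℝ) * (2 * Real.log 2) ≤ s ^ 2 / 3 * (2 * Real.log 2) := by
    gcongr
  have h₃ : (n : ℝ) * (2 * Real.log 2) = s ^ 2 * Real.log 2 := by
    rw [hs2]
    ring
  linarith

open Finset in
theorem five_le_card_primes_Ioc_of_large {n : ℕ} (hn : 1024 ≤ n) :
    5 ≤ #{p ∈ Ioc n (2 * n) | p.Prime} := by
  by_contra! h
  have h₁ := Nat.four_pow_lt_mul_centralBinom n (by lia)
  have h₂ := centralBinom_le_pow_card_primes_Ioc (show 2 < n by lia)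
  have h₃ : (2 * n) ^ (#{p ∈ Ioc n (2 * n) | p.Prime} + Nat.sqrt (2 * n)) ≤
      (2 * n) ^ (4 + Nat.sqrt (2 * n)) := Nat.pow_le_pow_right (by lia) (by lia)
  have h₄ := mul_pow_four_add_sqrt_mul_four_pow_le hn
  refine absurd h₁ (not_lt.mpr (le_trans ?_ h₄))
  gcongr
  exact h₂.trans (by gcongr)

open Finset in
theorem five_le_card_primes_Ioc_of_forall_mem {n : ℕ} (T : Finset ℕ) (hT : #T = 5)
    (hprime : ∀ p ∈ T, p.Prime) (hmem : ∀ p ∈ T, n < p ∧ p ≤ 2 * n) :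
    5 ≤ #{p ∈ Ioc n (2 * n) | p.Prime} :=
  hT ▸ card_le_card fun p hp ↦ mem_filter.mpr ⟨mem_Ioc.mpr (hmem p hp), hprime p hp⟩

open Finset in
theorem five_le_card_primes_Ioc {n : ℕ} (hn : 21 ≤ n) :
    5 ≤ #{p ∈ Ioc n (2 * n) | p.Prime} := by
  obtain hlarge | hsmall := le_or_gt 1024 n
  · exact five_le_card_primes_Ioc_of_large hlarge
  have : n < 23 ∨ 23 ≤ n ∧ n < 29 ∨ 29 ≤ n ∧ n < 37 ∨ 37 ≤ n ∧ n < 59 ∨ 59 ≤ n ∧ n < 101 ∨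
      101 ≤ n ∧ n < 181 ∨ 181 ≤ n ∧ n < 337 ∨ 337 ≤ n ∧ n < 647 ∨ 647 ≤ n := by lia
  rcases this with h | h | h | h | h | h | h | h | h
  · exact five_le_card_primes_Ioc_of_forall_mem {23, 29, 31, 37, 41} rfl
      (by norm_num) (by simp; lia)
  · exact five_le_card_primes_Ioc_of_forall_mem {29, 31, 37, 41, 43} rfl
      (by norm_num) (by simp; lia)
  · exact five_le_card_primes_Ioc_of_forall_mem {37, 41, 43, 47, 53} rfl
      (by norm_num) (by simp; lia)
  · exact five_le_card_primes_Ioc_of_forall_mem {59, 61, 67, 71, 73} rfl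
      (by norm_num) (by simp; lia)
  · exact five_le_card_primes_Ioc_of_forall_mem {101, 103, 107, 109, 113} rfl
      (by norm_num) (by simp; lia)
  · exact five_le_card_primes_Ioc_of_forall_mem {181, 191, 193, 197, 199} rfl
      (by norm_num) (by simp; lia)
  · exact five_le_card_primes_Ioc_of_forall_mem {337, 347, 349, 353, 359} rfl
      (by norm_num) (by simp; lia)
  · exact five_le_card_primes_Ioc_of_forall_mem {647, 653, 659, 661, 673} rfl
      (by norm_num) (by simp; lia)
  · exact five_le_card_primes_Ioc_of_forall_mem {1277, 1279, 1283, 1289, 1291} rfl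
      (by norm_num) (by simp; lia)

theorem four_primes_in_interval
    (n p : ℕ) (hn : 42 ≤ n)
    (hp : p.Prime) (hpn : p ≤ n)
    (hmax : ∀ q : ℕ, q.Prime → q ≤ n → q ≤ p) :
    4 ≤ {r : ℕ | r.Prime ∧ 2 * r > n ∧ r < p}.encard := by
  set T := {q ∈ Finset.Ioc (n / 2) (2 * (n / 2)) | q.Prime} with hT
  have hcard : 4 ≤ (T.erase p).card := by
    have h₁ : 5 ≤ T.card := five_le_card_primes_Ioc (by lia)
    have h₂ := Finset.pred_card_le_card_erase (s := T) (a := p)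
    lia
  have hsub : (T.erase p : Set ℕ) ⊆ {r : ℕ | r.Prime ∧ 2 * r > n ∧ r < p} := by
    intro r hr
    simp only [hT, Finset.mem_coe, Finset.mem_erase, Finset.mem_filter, Finset.mem_Ioc] at hr
    obtain ⟨hne, ⟨hlt, hle⟩, hr⟩ := hr
    exact ⟨hr, by lia, lt_of_le_of_ne (hmax r hr (by lia)) hne⟩
  refine le_trans ?_ (Set.encard_le_encard hsub)
  rw [Set.encard_coe_eq_coe_finsetCard]
  exact_mod_cast hcard
end
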